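/- arXiv:1511.08456 — 2 statements merged into one kernel-verified Lean document; each statement's English description precedes it below -/
import Mathlib

section
/- A POMDP P with goal state G has a memoryless almost-sure winning strategy for Reach({G}) if and only if it has a memoryless almost-sure winning strategy σ that is uniform on its support, i.e., such that for all actions a, a' ∈ A and every state s ∈ S, if σ(s)(a) > 0 and σ(s)(a') > 0 then σ(s)(a) = σ(s)(a'). -/
open scoped ENNReal
open Filter
open scoped Classical

/-- A POMDP with state space `S`, action alphabet `A`, observations `Z`,
probabilistic transition function, observation function, initial state and goal state. -/
structure POMDP (S A Z : Type) where
  trans : S → A → PMF S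
  obs : S → Z
  init : S
  goal : S

namespace POMDP

variable {S A Z : Type}

/-- A memoryless (observation-stationary) strategy: states with equal observations
get equal distributions over actions. -/
def Memoryless (P : POMDP S A Z) (σ : S → PMF A) : Prop :=
  ∀ s s' : S, P.obs s = P.obs s' → σ s = σ s'

/-- Finite-horizon reach probabilities `p_n` for the goal state under strategy `σ`. -/
noncomputable def preach (P : POMDP S A Z) (σ : S → PMF A) : ℕ → S → ℝ≥0∞
  | 0, s => if s = P.goal then 1 else 0
  | n + 1, s =>
      if s = P.goal then 1
      else ∑' a : A, σ s a * ∑' s' : S, P.trans s a s' * P.preach σ n s'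

/-- `σ` is almost-sure winning for `Reach({G})` iff `p_n(I) → 1`. -/
def AlmostSureWinning (P : POMDP S A Z) (σ : S → PMF A) : Prop :=
  Tendsto (fun n => P.preach σ n P.init) atTop (nhds 1)

/-- A finite path `(s₁, a₁, …, s_{k+1})` (with `k+1` states, `k` transitions)
is compatible with `σ` if each action has positive strategy probability and each
transition has positive transition probability. -/
def IsCompatPath (P : POMDP S A Z) (σ : S → PMF A) (k : ℕ)
    (st : Fin (k + 1) → S) (ac : Fin k → A) : Prop :=
  ∀ i : Fin k,
    0 < σ (st i.castSucc) (ac i) ∧ 0 < P.trans (st i.castSucc) (ac i) (st i.succ)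

/-- `R_σ`: the least set of states containing the initial state and closed under
σ-positive one-step transitions. -/
inductive ReachSet (P : POMDP S A Z) (σ : S → PMF A) : S → Prop
  | init : ReachSet P σ P.init
  | step {s s' : S} (a : A) :
      ReachSet P σ s → 0 < σ s a → 0 < P.trans s a s' → ReachSet P σ s'

end POMDP

/-- A weighted average determines the dominating function on the support of the weights. -/
theorem PMF.eq_of_tsum_mul_eq {α : Type*} (p : PMF α) {f g : α → ℝ≥0∞}
    (hle : ∀ a, p a ≠ 0 → f a ≤ g a) (hf : ∑' a, p a * f a ≠ ∞)
    (heq : ∑' a, p a * f a = ∑' a, p a * g a) {a : α} (ha : p a ≠ 0) : f a = g a := by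
  have hmul : ∀ b, p b * f b ≤ p b * g b := by
    intro b
    by_cases hb : p b = 0
    · simp [hb]
    · gcongr
      exact hle b hb
  refine (hle a ha).antisymm (not_lt.1 fun hlt => ?_)
  refine (ENNReal.tsum_lt_tsum (i := a) hf hmul ?_).ne heq
  exact (ENNReal.mul_lt_mul_iff_right ha (p.apply_ne_top a)).2 hlt

namespace POMDP

variable {S A Z : Type}

/-- The one-step transition distribution of the Markov chain induced by `σ`. -/
noncomputable def chain (P : POMDP S A Z) (σ : S → PMF A) (s : S) : PMF S :=
  (σ s).bind (P.trans s)

theorem chain_ne_zero_iff_of_support_eq (P : POMDP S A Z) {σ τ : S → PMF A}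
    (h : ∀ s, (σ s).support = (τ s).support) (s s' : S) :
    P.chain σ s s' ≠ 0 ↔ P.chain τ s s' ≠ 0 := by
  simp only [← PMF.mem_support_iff, chain, PMF.mem_support_bind_iff, h]

theorem preach_goal (P : POMDP S A Z) (σ : S → PMF A) (n : ℕ) : P.preach σ n P.goal = 1 := by
  cases n <;> simp [preach]

theorem preach_succ (P : POMDP S A Z) (σ : S → PMF A) (n : ℕ) {s : S} (hs : s ≠ P.goal) :
    P.preach σ (n + 1) s = ∑' s', P.chain σ s s' * P.preach σ n s' := by
  simp only [preach, hs, if_false, chain, PMF.bind_apply, ← ENNReal.tsum_mul_left,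
    ← ENNReal.tsum_mul_right, mul_assoc]
  exact ENNReal.tsum_comm

theorem preach_le_one (P : POMDP S A Z) (σ : S → PMF A) (n : ℕ) (s : S) :
    P.preach σ n s ≤ 1 := by
  induction n generalizing s with
  | zero => simp only [preach]; split_ifs <;> simp
  | succ n ih =>
    by_cases hs : s = P.goal
    · rw [hs, preach_goal]
    · rw [preach_succ P σ n hs, ← (P.chain σ s).tsum_coe]
      exact ENNReal.tsum_le_tsum fun s' => mul_le_of_le_one_right' (ih s')

theorem preach_mono (P : POMDP S A Z) (σ : S → PMF A) (s : S) :
    Monotone fun n => P.preach σ n s := by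
  refine monotone_nat_of_le_succ fun n => ?_
  induction n generalizing s with
  | zero =>
    by_cases hs : s = P.goal
    · simp [hs, preach_goal]
    · simp [preach, hs]
  | succ n ih =>
    by_cases hs : s = P.goal
    · simp [hs, preach_goal]
    · rw [preach_succ P σ n hs, preach_succ P σ (n + 1) hs]
      gcongr with t
      exact ih t

/-- The probability of eventually reaching the goal. -/
noncomputable def reachProb (P : POMDP S A Z) (σ : S → PMF A) (s : S) : ℝ≥0∞ :=
  ⨆ n, P.preach σ n s

theorem tendsto_preach (P : POMDP S A Z) (σ : S → PMF A) (s : S) :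
    Tendsto (fun n => P.preach σ n s) atTop (nhds (P.reachProb σ s)) :=
  tendsto_atTop_iSup (P.preach_mono σ s)

theorem almostSureWinning_iff (P : POMDP S A Z) (σ : S → PMF A) :
    P.AlmostSureWinning σ ↔ P.reachProb σ P.init = 1 :=
  ⟨tendsto_nhds_unique (P.tendsto_preach σ P.init), fun h => by
    simpa only [AlmostSureWinning, h] using P.tendsto_preach σ P.init⟩

theorem reachProb_goal (P : POMDP S A Z) (σ : S → PMF A) : P.reachProb σ P.goal = 1 := by
  simp [reachProb, preach_goal]

theorem reachProb_le_one (P : POMDP S A Z) (σ : S → PMF A) (s : S) : P.reachProb σ s ≤ 1 :=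
  iSup_le fun n => P.preach_le_one σ n s

theorem reachProb_eq_tsum [Fintype S] (P : POMDP S A Z) (σ : S → PMF A) {s : S}
    (hs : s ≠ P.goal) :
    P.reachProb σ s = ∑' s', P.chain σ s s' * P.reachProb σ s' := by
  refine tendsto_nhds_unique ((tendsto_add_atTop_iff_nat 1).2 (P.tendsto_preach σ s)) ?_
  simp only [preach_succ P σ _ hs, tsum_fintype]
  exact tendsto_finsetSum _ fun t _ =>
    ENNReal.Tendsto.const_mul (P.tendsto_preach σ t) (Or.inr ((P.chain σ s).apply_ne_top t))

/-- Successors of an almost-surely winning non-goal state are almost-surely winning. -/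
theorem reachProb_eq_one_of_chain_ne_zero [Fintype S] (P : POMDP S A Z) (σ : S → PMF A)
    {s s' : S} (hs : s ≠ P.goal) (h : P.reachProb σ s = 1) (hs' : P.chain σ s s' ≠ 0) :
    P.reachProb σ s' = 1 := by
  rw [reachProb_eq_tsum P σ hs] at h
  refine (P.chain σ s).eq_of_tsum_mul_eq (g := fun _ => 1)
    (fun s' _ => P.reachProb_le_one σ s') (by rw [h]; exact ENNReal.one_ne_top) ?_ hs'
  simp only [h, mul_one, (P.chain σ s).tsum_coe]

theorem preach_ne_zero_of_chain (P : POMDP S A Z) {σ τ : S → PMF A}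
    (h : ∀ s s', P.chain σ s s' ≠ 0 → P.chain τ s s' ≠ 0) (n : ℕ) (s : S)
    (hn : P.preach σ n s ≠ 0) : P.preach τ n s ≠ 0 := by
  induction n generalizing s with
  | zero => exact hn
  | succ n ih =>
    by_cases hs : s = P.goal
    · simp [hs, preach_goal]
    · rw [preach_succ P _ n hs, Ne, ENNReal.tsum_eq_zero, not_forall] at hn ⊢
      obtain ⟨t, ht⟩ := hn
      rw [mul_eq_zero, not_or] at ht
      exact ⟨t, mul_ne_zero (h s t ht.1) (ih t ht.2)⟩

/-- If the goal stays reachable with positive probability throughout a set of states closed under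
transitions from non-goal states, then it is reached almost surely from that set. -/
theorem reachProb_eq_one_of_closed [Fintype S] (P : POMDP S A Z) (τ : S → PMF A) (C : Set S)
    (hclosed : ∀ s ∈ C, s ≠ P.goal → ∀ s', P.chain τ s s' ≠ 0 → s' ∈ C)
    (hpos : ∀ s ∈ C, ∃ n, P.preach τ n s ≠ 0) {s : S} (hs : s ∈ C) :
    P.reachProb τ s = 1 := by
  obtain ⟨s₀, hs₀, hmin⟩ := C.toFinite.exists_minimalFor (P.reachProb τ) C ⟨s, hs⟩
  replace hmin : ∀ t ∈ C, P.reachProb τ s₀ ≤ P.reachProb τ t := fun t ht =>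
    (le_total _ _).elim id (hmin ht)
  have key : ∀ n, ∀ t ∈ C, P.reachProb τ t = P.reachProb τ s₀ → P.preach τ n t ≠ 0 →
      P.reachProb τ s₀ = 1 := by
    intro n
    induction n with
    | zero =>
      intro t _ hv hn
      by_cases hg : t = P.goal
      · rw [← hv, hg, reachProb_goal]
      · simp [preach, hg] at hn
    | succ n ih =>
      intro t ht hv hn
      by_cases hg : t = P.goal
      · rw [← hv, hg, reachProb_goal]
      · rw [preach_succ P _ n hg, Ne, ENNReal.tsum_eq_zero, not_forall] at hn
        obtain ⟨t', ht'⟩ := hn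
        rw [mul_eq_zero, not_or] at ht'
        have hsum : ∑' x, P.chain τ t x * P.reachProb τ s₀ = P.reachProb τ s₀ := by
          rw [ENNReal.tsum_mul_right, PMF.tsum_coe, one_mul]
        refine ih t' (hclosed t ht hg t' ht'.1) ?_ ht'.2
        refine ((P.chain τ t).eq_of_tsum_mul_eq (f := fun _ => P.reachProb τ s₀)
          (fun x hx => hmin x (hclosed t ht hg x hx)) ?_ ?_ ht'.1).symm
        · rw [hsum]
          exact ((P.reachProb_le_one τ s₀).trans_lt ENNReal.one_lt_top).ne
        · rw [hsum, ← hv, reachProb_eq_tsum P τ hg]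
  obtain ⟨n, hn⟩ := hpos s₀ hs₀
  exact (P.reachProb_le_one τ s).antisymm (key n s₀ hs₀ rfl hn ▸ hmin s hs)

/-- Almost-sure winning depends only on the supports of the strategy. -/
theorem AlmostSureWinning.of_support_eq [Fintype S] {P : POMDP S A Z} {σ τ : S → PMF A}
    (hσ : P.AlmostSureWinning σ) (h : ∀ s, (σ s).support = (τ s).support) :
    P.AlmostSureWinning τ := by
  have hchain := P.chain_ne_zero_iff_of_support_eq h
  rw [almostSureWinning_iff] at hσ ⊢
  refine P.reachProb_eq_one_of_closed τ {s | P.reachProb σ s = 1} ?_ ?_ hσ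
  · intro s hs hg s' hs'
    exact P.reachProb_eq_one_of_chain_ne_zero σ hg hs ((hchain s s').2 hs')
  · intro s hs
    by_contra! hzero
    have hσ_zero : ∀ n, P.preach σ n s = 0 := fun n => by
      by_contra hn
      exact P.preach_ne_zero_of_chain (fun s s' => (hchain s s').1) n s hn (hzero n)
    simp [reachProb, hσ_zero] at hs

end POMDP

/-- The uniform distribution on the support of `p`. -/
noncomputable def PMF.uniformOnSupport {A : Type*} [Fintype A] (p : PMF A) : PMF A :=
  PMF.uniformOfFinset p.support.toFinset (Set.toFinset_nonempty.2 p.support_nonempty)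

theorem PMF.support_uniformOnSupport {A : Type*} [Fintype A] (p : PMF A) :
    p.uniformOnSupport.support = p.support := by
  simp [uniformOnSupport]

theorem PMF.uniformOnSupport_apply_eq {A : Type*} [Fintype A] (p : PMF A) {a a' : A}
    (ha : 0 < p.uniformOnSupport a) (ha' : 0 < p.uniformOnSupport a') :
    p.uniformOnSupport a = p.uniformOnSupport a' := by
  rw [PMF.apply_pos_iff] at ha ha'
  simp only [uniformOnSupport, PMF.mem_support_uniformOfFinset_iff] at ha ha'
  simp only [uniformOnSupport, PMF.uniformOfFinset_apply, ha, ha', if_true]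

/-- There is a memoryless almost-sure winning strategy iff there is one that is
uniform on its support. -/
theorem exists_winning_iff_exists_uniform_winning
    {S A Z : Type} [Fintype S] [Nonempty S] [Fintype A] [Nonempty A] [Fintype Z]
    (P : POMDP S A Z) :
    (∃ σ : S → PMF A, P.Memoryless σ ∧ P.AlmostSureWinning σ) ↔
      (∃ σ : S → PMF A, P.Memoryless σ ∧ P.AlmostSureWinning σ ∧
        ∀ (s : S) (a a' : A), 0 < σ s a → 0 < σ s a' → σ s a = σ s a') := by
  constructor
  · rintro ⟨σ, hmem, hwin⟩
    refine ⟨fun s => (σ s).uniformOnSupport, fun s s' h => ?_, ?_,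
      fun s a a' => (σ s).uniformOnSupport_apply_eq⟩
    · simp only [hmem s s' h]
    · exact hwin.of_support_eq fun s => (σ s).support_uniformOnSupport.symm
  · rintro ⟨σ, hmem, hwin, -⟩
    exact ⟨σ, hmem, hwin⟩
end

section
/- Let σ = (σ_u, σ_n, M, m₀) and σ' = (σ'_u, σ'_n, M, m₀) be small-memory strategies over the same memory set M with identical supports, i.e., for all m ∈ M, a ∈ A: σ_n(m)(a) > 0 ⟺ σ'_n(m)(a) > 0, and for all m, m' ∈ M, z ∈ Z, a ∈ A: σ_u(m,z,a)(m') > 0 ⟺ σ'_u(m,z,a)(m') > 0. Then σ is almost-sure winning for Reach({G}) if and only if σ' is almost-sure winning for Reach({G}). -/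
open scoped ENNReal
open Filter
open scoped Classical

namespace POMDP

variable {S A Z : Type}

/-- Finite-horizon reach probabilities `q_n : S × M → [0,1]` for a strategy with
memory given by action selection function `σn` and memory update function `σu`. -/
noncomputable def qreach (P : POMDP S A Z) {M : Type}
    (σn : M → PMF A) (σu : M → Z → A → PMF M) : ℕ → S → M → ℝ≥0∞
  | 0, s, _ => if s = P.goal then 1 else 0
  | n + 1, s, m =>
      if s = P.goal then 1
      else ∑' a : A, σn m a * ∑' s' : S, P.trans s a s' *
        ∑' m' : M, σu m (P.obs s) a m' * P.qreach σn σu n s' m'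

/-- A finite sequence `(s₁, m₁, a₁, …, s_{k+1}, m_{k+1})` (with `k+1` state–memory
pairs) is a σ-compatible path for the strategy with memory `(σn, σu)`. -/
def IsCompatPathMem (P : POMDP S A Z) {M : Type}
    (σn : M → PMF A) (σu : M → Z → A → PMF M) (k : ℕ)
    (st : Fin (k + 1) → S) (mem : Fin (k + 1) → M) (ac : Fin k → A) : Prop :=
  ∀ i : Fin k,
    0 < P.trans (st i.castSucc) (ac i) (st i.succ) ∧
    0 < σn (mem i.castSucc) (ac i) ∧
    0 < σu (mem i.castSucc) (P.obs (st i.castSucc)) (ac i) (mem i.succ)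

end POMDP

namespace PMF

variable {X Y : Type*}

/-- Expectations against a bind are iterated expectations. -/
theorem tsum_bind_mul (p : PMF X) (g : X → PMF Y) (f : Y → ℝ≥0∞) :
    ∑' y, p.bind g y * f y = ∑' x, p x * ∑' y, g x y * f y := by
  simp_rw [PMF.bind_apply, ← ENNReal.tsum_mul_right, ← ENNReal.tsum_mul_left]
  rw [ENNReal.tsum_comm]
  simp_rw [mul_assoc]

theorem tsum_pure_mul (x : X) (f : X → ℝ≥0∞) : ∑' y, PMF.pure x y * f y = f x := by
  rw [tsum_eq_single x]
  · simp
  · intro y hy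
    simp [hy]

theorem tsum_map_mul (p : PMF X) (g : X → Y) (f : Y → ℝ≥0∞) :
    ∑' y, p.map g y * f y = ∑' x, p x * f (g x) := by
  rw [← PMF.bind_pure_comp, tsum_bind_mul]
  simp_rw [Function.comp_apply, tsum_pure_mul]

/-- Two functions that are comparable on the support of `p` and have the same finite expectation
agree on the support. -/
theorem eq_on_support_of_tsum_eq (p : PMF X) {f g : X → ℝ≥0∞}
    (hle : ∀ x ∈ p.support, f x ≤ g x) (heq : ∑' x, p x * f x = ∑' x, p x * g x)
    (htop : ∑' x, p x * f x ≠ ⊤) {x : X} (hx : x ∈ p.support) : f x = g x := by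
  by_contra hne
  refine (ENNReal.tsum_lt_tsum (i := x) htop (fun y => ?_) ?_).ne heq
  · by_cases hy : y ∈ p.support
    · exact mul_le_mul_right (hle y hy) _
    · simp [(p.apply_eq_zero_iff y).2 hy]
  · exact (ENNReal.mul_lt_mul_iff_right hx (p.apply_ne_top x)).2 (lt_of_le_of_ne (hle x hx) hne)

end PMF

/-- Probability that the Markov chain with kernel `K` hits `G` within `n` steps. -/
noncomputable def hitProb {X : Type*} (K : X → PMF X) (G : Set X) : ℕ → X → ℝ≥0∞
  | 0, x => if x ∈ G then 1 else 0
  | n + 1, x => if x ∈ G then 1 else ∑' y, K x y * hitProb K G n y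

section hitProb

variable {X : Type*} {K K' : X → PMF X} {G : Set X}

theorem hitProb_of_mem {x : X} (hx : x ∈ G) (n : ℕ) : hitProb K G n x = 1 := by
  cases n <;> simp [hitProb, hx]

theorem hitProb_le_one (n : ℕ) (x : X) : hitProb K G n x ≤ 1 := by
  induction n generalizing x with
  | zero => rw [hitProb]; split_ifs <;> simp
  | succ n ih =>
    rw [hitProb]
    split_ifs
    · exact le_rfl
    · calc ∑' y, K x y * hitProb K G n y ≤ ∑' y, K x y :=
            ENNReal.tsum_le_tsum fun y => mul_le_of_le_one_right' (ih y)
        _ = 1 := (K x).tsum_coe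

theorem hitProb_le_succ (n : ℕ) (x : X) : hitProb K G n x ≤ hitProb K G (n + 1) x := by
  induction n generalizing x with
  | zero =>
    by_cases hx : x ∈ G
    · simp [hitProb_of_mem hx]
    · simp [hitProb, hx]
  | succ n ih =>
    rw [hitProb, hitProb]
    split_ifs
    · exact le_rfl
    · exact ENNReal.tsum_le_tsum fun y => mul_le_mul_right (ih y) _

theorem tendsto_hitProb (x : X) :
    Tendsto (fun n => hitProb K G n x) atTop (nhds (⨆ n, hitProb K G n x)) :=
  tendsto_atTop_iSup (monotone_nat_of_le_succ fun n => hitProb_le_succ n x)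

theorem iSup_hitProb_of_mem {x : X} (hx : x ∈ G) : ⨆ n, hitProb K G n x = 1 := by
  simp [hitProb_of_mem hx]

theorem iSup_hitProb_le_one (x : X) : ⨆ n, hitProb K G n x ≤ 1 :=
  iSup_le fun n => hitProb_le_one n x

/-- The eventual hitting probability is harmonic off the target. -/
theorem iSup_hitProb_eq_tsum [Finite X] {x : X} (hx : x ∉ G) :
    ⨆ n, hitProb K G n x = ∑' y, K x y * ⨆ n, hitProb K G n y := by
  have := Fintype.ofFinite X
  refine tendsto_nhds_unique ((tendsto_hitProb x).comp (tendsto_add_atTop_nat 1)) ?_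
  simp only [Function.comp_def, hitProb, hx, if_false, tsum_fintype]
  exact tendsto_finsetSum _ fun y _ =>
    ENNReal.Tendsto.const_mul (tendsto_hitProb y) (Or.inr ((K x).apply_ne_top y))

/-- A set that is disjoint from the target and cannot be left never hits the target. -/
theorem hitProb_eq_zero_of_closed {C : Set X} (hG : ∀ x ∈ C, x ∉ G)
    (hC : ∀ x ∈ C, ∀ y ∈ (K x).support, y ∈ C) (n : ℕ) {x : X} (hx : x ∈ C) :
    hitProb K G n x = 0 := by
  induction n generalizing x with
  | zero => simp [hitProb, hG x hx]
  | succ n ih =>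
    rw [hitProb, if_neg (hG x hx), ENNReal.tsum_eq_zero]
    intro y
    by_cases hy : y ∈ (K x).support
    · simp [ih (hC x hx y hy)]
    · simp [((K x).apply_eq_zero_iff y).2 hy]

/-- States visited before the target by an almost surely hitting chain also hit almost surely. -/
theorem iSup_hitProb_eq_one_of_step [Finite X] {x y : X} (hx : ⨆ n, hitProb K G n x = 1)
    (hxG : x ∉ G) (hy : y ∈ (K x).support) : ⨆ n, hitProb K G n y = 1 := by
  have hsum : ∑' y, K x y * (⨆ n, hitProb K G n y) = 1 := by rw [← iSup_hitProb_eq_tsum hxG, hx]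
  exact (K x).eq_on_support_of_tsum_eq (g := fun _ => 1) (fun z _ => iSup_hitProb_le_one z)
    (by simp [hsum, (K x).tsum_coe]) (by simp [hsum]) hy

/-- Almost sure hitting depends only on the supports of the kernel of a finite chain. -/
theorem iSup_hitProb_eq_one_of_support_eq [Finite X] (hK : ∀ x, (K x).support = (K' x).support)
    {x : X} (hx : ⨆ n, hitProb K G n x = 1) : ⨆ n, hitProb K' G n x = 1 := by
  set h' : X → ℝ≥0∞ := fun x => ⨆ n, hitProb K' G n x
  obtain ⟨w, hw, hmin⟩ := Set.exists_min_image {x | ⨆ n, hitProb K G n x = 1} h'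
    (Set.toFinite _) ⟨x, hx⟩
  suffices hw1 : h' w = 1 from le_antisymm (iSup_hitProb_le_one x) (hw1 ▸ hmin x hx)
  by_contra hne
  have hG : ∀ v, h' v = h' w → v ∉ G := fun v hv hvG =>
    hne (hv ▸ iSup_hitProb_of_mem hvG)
  have hfin : h' w ≠ ⊤ := ((iSup_hitProb_le_one w).trans_lt ENNReal.one_lt_top).ne
  have hzero : ∀ n, hitProb K G n w = 0 := fun n =>
    hitProb_eq_zero_of_closed (C := {v | ⨆ n, hitProb K G n v = 1 ∧ h' v = h' w})
      (fun v hv => hG v hv.2)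
      (fun v hv y hy => by
        have hstep : ∀ z ∈ (K v).support, ⨆ n, hitProb K G n z = 1 := fun z hz =>
          iSup_hitProb_eq_one_of_step hv.1 (hG v hv.2) hz
        have hconst : ∑' z, K' v z * h' w = h' w := by
          rw [ENNReal.tsum_mul_right, (K' v).tsum_coe, one_mul]
        refine ⟨hstep y hy, ((K' v).eq_on_support_of_tsum_eq (f := fun _ => h' w) (g := h')
          (fun z hz => hmin z (hstep z (hK v ▸ hz))) ?_ (by rwa [hconst]) (hK v ▸ hy)).symm⟩
        rw [hconst, ← hv.2]
        exact iSup_hitProb_eq_tsum (hG v hv.2))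
      n ⟨hw, rfl⟩
  have hw1 : ⨆ n, hitProb K G n w = 1 := hw
  simp [hzero] at hw1

theorem tendsto_hitProb_one_iff (x : X) :
    Tendsto (fun n => hitProb K G n x) atTop (nhds 1) ↔ ⨆ n, hitProb K G n x = 1 :=
  ⟨fun h => tendsto_nhds_unique (tendsto_hitProb x) h, fun h => h ▸ tendsto_hitProb x⟩

end hitProb

namespace POMDP

variable {S A Z M : Type}

/-- The Markov chain on state-memory pairs induced by a strategy with memory. -/
noncomputable def memKernel (P : POMDP S A Z) (σn : M → PMF A) (σu : M → Z → A → PMF M)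
    (x : S × M) : PMF (S × M) :=
  (σn x.2).bind fun a => (P.trans x.1 a).bind fun s' => (σu x.2 (P.obs x.1) a).map (Prod.mk s')

theorem qreach_eq_hitProb (P : POMDP S A Z) (σn : M → PMF A) (σu : M → Z → A → PMF M)
    (n : ℕ) (s : S) (m : M) :
    P.qreach σn σu n s m = hitProb (P.memKernel σn σu) {x | x.1 = P.goal} n (s, m) := by
  induction n generalizing s m with
  | zero => simp [qreach, hitProb]
  | succ n ih =>
    simp only [qreach, hitProb, memKernel, PMF.tsum_bind_mul, PMF.tsum_map_mul, ih,
      Set.mem_ofPred_eq]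

theorem support_memKernel_congr (P : POMDP S A Z) {σn σn' : M → PMF A}
    {σu σu' : M → Z → A → PMF M} (hn : ∀ m, (σn m).support = (σn' m).support)
    (hu : ∀ m z a, (σu m z a).support = (σu' m z a).support) (x : S × M) :
    (P.memKernel σn σu x).support = (P.memKernel σn' σu' x).support := by
  simp only [memKernel, PMF.support_bind, PMF.support_map, hn, hu]

end POMDP

/-- Two small-memory strategies over the same memory set with identical supports
are equi-winning. -/
theorem smallMemory_winning_iff_of_same_support
    {S A Z : Type} [Fintype S] [Nonempty S] [Fintype A] [Nonempty A] [Fintype Z]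
    (P : POMDP S A Z) (M : Type) [Finite M] (m₀ : M)
    (σn σn' : M → PMF A) (σu σu' : M → Z → A → PMF M)
    (hn : ∀ (m : M) (a : A), 0 < σn m a ↔ 0 < σn' m a)
    (hu : ∀ (m m' : M) (z : Z) (a : A), 0 < σu m z a m' ↔ 0 < σu' m z a m') :
    Tendsto (fun n => P.qreach σn σu n P.init m₀) atTop (nhds 1) ↔
      Tendsto (fun n => P.qreach σn' σu' n P.init m₀) atTop (nhds 1) := by
  have hn' : ∀ m, (σn m).support = (σn' m).support := fun m => by
    ext a; simpa only [PMF.mem_support_iff, pos_iff_ne_zero] using hn m a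
  have hu' : ∀ m z a, (σu m z a).support = (σu' m z a).support := fun m z a => by
    ext m'; simpa only [PMF.mem_support_iff, pos_iff_ne_zero] using hu m m' z a
  have hK := P.support_memKernel_congr hn' hu'
  simp only [POMDP.qreach_eq_hitProb, tendsto_hitProb_one_iff]
  exact ⟨iSup_hitProb_eq_one_of_support_eq hK,
    iSup_hitProb_eq_one_of_support_eq fun x => (hK x).symm⟩
end
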